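/- Let G be a finite, 3-regular, vertex-transitive simple graph on vertex set V and let λ_min be the least eigenvalue of its adjacency matrix. Then there exist two disjoint independent sets I₁ and I₂ in G with |I₁ ∪ I₂| ≥ 2·(1/2 − (3/(4π))·arccos((1 − λ_min)/4))·|V|; in particular, the induced subgraph on I₁ ∪ I₂ is bipartite. -/

import Mathlib

open Matrix

open Real MeasureTheory InnerProductGeometry

lemma cos_sq_half_sum_ge {x w₁ w₂ w₃ a b c p q : ℝ} (hx : 1 ≤ x) (h1 : 0 < w₁) (h2 : 0 < w₂)
    (h3 : 0 < w₃) (ha : |a| ≤ 1) (hb : |b| ≤ 1) (hc : |c| ≤ 1)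
    (e1 : x * w₁ = c * w₂ + b * w₃) (e2 : x * w₂ = c * w₁ + a * w₃)
    (e3 : x * w₃ = b * w₁ + a * w₂) (hq : q ^ 2 ≤ 1)
    (hsum : a + b = 2 * (p * q)) (hprod : a * b = p ^ 2 + q ^ 2 - 1) :
    x * (x - c) / 2 ≤ p ^ 2 := by
  rw [abs_le] at ha hb hc
  have hw : w₃ ≤ w₁ + w₂ := by nlinarith
  have hab : (a + b) * w₃ = (x - c) * (w₁ + w₂) := by linarith
  have hdet : x ^ 3 - x * (a ^ 2 + b ^ 2 + c ^ 2) - 2 * a * b * c = 0 := by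
    have : w₃ * (x ^ 3 - x * (a ^ 2 + b ^ 2 + c ^ 2) - 2 * a * b * c) = 0 := by
      have m1 : (x ^ 2 - c ^ 2) * w₁ = (x * b + a * c) * w₃ := by linear_combination x * e1 + c * e2
      have m2 : (x ^ 2 - c ^ 2) * w₂ = (x * a + b * c) * w₃ := by linear_combination x * e2 + c * e1
      linear_combination (x ^ 2 - c ^ 2) * e3 + b * m1 + a * m2
    exact (mul_eq_zero.mp this).resolve_left h3.ne'
  set k := x * (x - c) / 2 with hk
  have hk0 : 0 ≤ k := by rw [hk]; nlinarith
  have hprodk : (p ^ 2 - k) * (x ^ 2 * q ^ 2 - k) = k * (x ^ 2 - 1) * (1 - q ^ 2) := by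
    have hs : a ^ 2 + b ^ 2 = 4 * (p * q) ^ 2 - 2 * (p ^ 2 + q ^ 2 - 1) := by
      linear_combination (a + b + 2 * (p * q)) * hsum - 2 * hprod
    have h' : x ^ 3 - x * (4 * (p * q) ^ 2 - 2 * (p ^ 2 + q ^ 2 - 1) + c ^ 2)
        - 2 * (p ^ 2 + q ^ 2 - 1) * c = 0 := by
      linear_combination hdet + x * hs + 2 * c * hprod
    rw [hk]
    linear_combination (-x / 4) * h'
  have hpq : k ^ 2 ≤ x ^ 2 * (p ^ 2 * q ^ 2) := by
    have : x * (p * q) * w₃ = k * (w₁ + w₂) := by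
      rw [hk]; linear_combination (x / 2) * hab - (x * w₃ / 2) * hsum
    have h5 : k * w₃ ≤ x * (p * q) * w₃ := by rw [this]; gcongr
    have h6 : k ≤ x * (p * q) := le_of_mul_le_mul_right h5 h3
    calc k ^ 2 ≤ (x * (p * q)) ^ 2 := by gcongr
      _ = _ := by ring
  by_contra! hlt
  have hx2 : 0 ≤ k * (x ^ 2 - 1) * (1 - q ^ 2) :=
    mul_nonneg (mul_nonneg hk0 (by nlinarith)) (by linarith)
  have hqk : x ^ 2 * q ^ 2 ≤ k := by
    by_contra! h
    nlinarith [mul_pos (sub_pos.2 hlt) (sub_pos.2 h)]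
  nlinarith [sq_nonneg p, mul_le_mul_of_nonneg_left hqk (sq_nonneg p),
    mul_lt_mul_of_pos_right hlt (lt_of_le_of_lt (sq_nonneg p) hlt)]

lemma arccos_sum_le_of_min {x w₁ w₂ w₃ a b c : ℝ} (hx : 1 ≤ x) (hx2 : x ≤ 2) (h1 : 0 < w₁)
    (h2 : 0 < w₂) (h3 : 0 < w₃) (ha : |a| ≤ 1) (hb : |b| ≤ 1) (hc : |c| ≤ 1)
    (e1 : x * w₁ = c * w₂ + b * w₃) (e2 : x * w₂ = c * w₁ + a * w₃)
    (e3 : x * w₃ = b * w₁ + a * w₂) (h31 : w₃ ≤ w₁) (h32 : w₃ ≤ w₂) :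
    arccos a + arccos b + arccos c ≤ 3 * arccos (x / 2) := by
  have ha' := abs_le.mp ha
  have hb' := abs_le.mp hb
  have hc' := abs_le.mp hc
  have hcx : x / 2 ≤ c := by
    have h : 2 * w₁ * w₂ * c = x * (w₁ ^ 2 + w₂ ^ 2 - w₃ ^ 2) := by
      linear_combination w₃ * e3 - w₁ * e1 - w₂ * e2
    have h' : w₁ * w₂ ≤ w₁ ^ 2 + w₂ ^ 2 - w₃ ^ 2 := by
      rcases le_total w₁ w₂ with h | h <;> nlinarith
    have h'' : (w₁ * w₂) * (x / 2) ≤ (w₁ * w₂) * c := by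
      nlinarith [mul_le_mul_of_nonneg_left h' (zero_le_one.trans hx)]
    exact le_of_mul_le_mul_left h'' (mul_pos h1 h2)
  have ca := cos_arccos ha'.1 ha'.2
  have cb := cos_arccos hb'.1 hb'.2
  have cc := cos_arccos hc'.1 hc'.2
  have cd := cos_arccos (show -1 ≤ x / 2 by linarith) (show x / 2 ≤ 1 by linarith)
  have hγδ : arccos c ≤ arccos (x / 2) := arccos_le_arccos hcx
  have hδ : arccos (x / 2) ≤ π / 3 := by
    rw [← arccos_cos (x := π / 3) (by positivity) (by linarith [pi_pos]), cos_pi_div_three]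
    exact arccos_le_arccos (by linarith)
  have hα0 := arccos_nonneg a
  have hβ0 := arccos_nonneg b
  have hγ0 := arccos_nonneg c
  have hα1 := arccos_le_pi a
  have hβ1 := arccos_le_pi b
  set α := arccos a
  set β := arccos b
  set γ := arccos c
  set δ := arccos (x / 2)
  have hsum : a + b = 2 * (cos ((α + β) / 2) * cos ((α - β) / 2)) := by
    rw [← ca, ← cb, cos_add_cos]; ring
  have hprod : a * b = cos ((α + β) / 2) ^ 2 + cos ((α - β) / 2) ^ 2 - 1 := by
    rw [cos_sq, cos_sq, ← ca, ← cb, mul_div_cancel₀ _ two_ne_zero, mul_div_cancel₀ _ two_ne_zero,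
      cos_add, cos_sub]
    ring
  have hkey := cos_sq_half_sum_ge hx h1 h2 h3 ha hb hc e1 e2 e3 (cos_sq_le_one _) hsum hprod
  have hcos2 : cos ((3 * δ - γ) / 2) ^ 2 ≤ x * (x - c) / 2 := by
    have hxδ : x = 2 * cos δ := by linarith
    have t1 : cos (3 * δ - γ) + cos (δ + γ) = 2 * cos (2 * δ) * cos (δ - γ) := by
      rw [cos_add_cos]; congr 2 <;> ring_nf
    have t2 : 0 ≤ (1 + 2 * cos (2 * δ)) * (1 - cos (δ - γ)) := by
      refine mul_nonneg ?_ (by linarith [cos_le_one (δ - γ)])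
      rw [cos_two_mul]; nlinarith
    rw [cos_add] at t1
    rw [cos_sub δ γ] at t1 t2
    rw [cos_sq, mul_div_cancel₀ _ two_ne_zero, hxδ, ← cc]
    have t3 := cos_two_mul δ
    linarith
  have hP : 0 ≤ cos ((α + β) / 2) := by
    by_contra! hneg
    have hPgt : π / 2 < (α + β) / 2 := by
      by_contra! h
      exact hneg.not_ge (cos_nonneg_of_mem_Icc ⟨by linarith [pi_pos], h⟩)
    have hQ : 0 < cos ((α - β) / 2) := cos_pos_of_mem_Ioo ⟨by linarith, by linarith⟩
    have : 0 ≤ (a + b) * w₃ := by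
      have : (a + b) * w₃ = (x - c) * (w₁ + w₂) := by linarith
      rw [this]; exact mul_nonneg (by linarith) (by linarith)
    have := nonneg_of_mul_nonneg_left this h3
    nlinarith [mul_pos_of_neg_of_neg hneg (neg_neg_of_pos hQ)]
  have hle : cos ((3 * δ - γ) / 2) ≤ cos ((α + β) / 2) :=
    (le_abs_self _).trans (abs_le_of_sq_le_sq (hcos2.trans hkey) hP)
  have := (strictAntiOn_cos.le_iff_ge (a := (3 * δ - γ) / 2) (b := (α + β) / 2)
    ⟨by linarith, by linarith⟩ ⟨by linarith, by linarith⟩).mp hle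
  linarith

lemma arccos_sum_le {x w₁ w₂ w₃ a b c : ℝ} (hx : 1 ≤ x) (hx2 : x ≤ 2) (h1 : 0 < w₁)
    (h2 : 0 < w₂) (h3 : 0 < w₃) (ha : |a| ≤ 1) (hb : |b| ≤ 1) (hc : |c| ≤ 1)
    (e1 : x * w₁ = c * w₂ + b * w₃) (e2 : x * w₂ = c * w₁ + a * w₃)
    (e3 : x * w₃ = b * w₁ + a * w₂) :
    arccos a + arccos b + arccos c ≤ 3 * arccos (x / 2) := by
  have : (w₃ ≤ w₁ ∧ w₃ ≤ w₂) ∨ (w₂ ≤ w₁ ∧ w₂ ≤ w₃) ∨ (w₁ ≤ w₂ ∧ w₁ ≤ w₃) := by grind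
  rcases this with ⟨h, h'⟩ | ⟨h, h'⟩ | ⟨h, h'⟩
  · exact arccos_sum_le_of_min hx hx2 h1 h2 h3 ha hb hc e1 e2 e3 h h'
  · have := arccos_sum_le_of_min hx hx2 h1 h3 h2 ha hc hb (by linarith) (by linarith) (by linarith)
      h h'
    linarith
  · have := arccos_sum_le_of_min hx hx2 h2 h3 h1 hb hc ha (by linarith) (by linarith) (by linarith)
      h h'
    linarith

section
variable {F : Type*} [NormedAddCommGroup F] [InnerProductSpace ℝ F]
open InnerProductGeometry

lemma angle_sum_le {z u₁ u₂ u₃ : F} {l : ℝ} (n1 : ‖u₁‖ = ‖z‖) (n2 : ‖u₂‖ = ‖z‖) (n3 : ‖u₃‖ = ‖z‖)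
    (h1 : z ≠ u₁) (h2 : z ≠ u₂) (h3 : z ≠ u₃) (hl : l ≤ -1) (hsum : u₁ + u₂ + u₃ = l • z) :
    angle (z - u₂) (z - u₃) + angle (z - u₁) (z - u₃) + angle (z - u₁) (z - u₂)
      ≤ 3 * arccos ((1 - l) / 4) := by
  have hz : 0 < ‖z‖ := by
    rw [norm_pos_iff]; rintro rfl
    rw [norm_zero, norm_eq_zero] at n1; exact h1 n1.symm
  have hl3 : -3 ≤ l := by
    have : ‖l • z‖ ≤ 3 * ‖z‖ := by
      rw [← hsum]; exact (norm_add₃_le).trans (by linarith)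
    rw [norm_smul, Real.norm_eq_abs] at this
    linarith [neg_abs_le l, le_of_mul_le_mul_right this hz]
  have half : ∀ u : F, ‖u‖ = ‖z‖ → inner ℝ (z - u) z = ‖z - u‖ ^ 2 / 2 := by
    intro u hu
    have := norm_sub_sq_real z u
    rw [this, hu, inner_sub_left, real_inner_self_eq_norm_sq, real_inner_comm z u]; ring
  have hs : (z - u₁) + (z - u₂) + (z - u₃) = (3 - l) • z := by
    rw [sub_smul, ← hsum, show (3 : ℝ) • z = z + z + z by module]; abel
  have i1 := half u₁ n1
  have i2 := half u₂ n2
  have i3 := half u₃ n3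
  have p1 : 0 < ‖z - u₁‖ := norm_pos_iff.2 (sub_ne_zero.2 h1)
  have p2 : 0 < ‖z - u₂‖ := norm_pos_iff.2 (sub_ne_zero.2 h2)
  have p3 : 0 < ‖z - u₃‖ := norm_pos_iff.2 (sub_ne_zero.2 h3)
  generalize z - u₁ = a₁ at *
  generalize z - u₂ = a₂ at *
  generalize z - u₃ = a₃ at *
  have ex : ∀ a : F, inner ℝ a a₁ + inner ℝ a a₂ + inner ℝ a a₃ = (3 - l) * inner ℝ a z := by
    intro a; rw [← inner_add_right, ← inner_add_right, hs, inner_smul_right]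
  have c12 := cos_angle_mul_norm_mul_norm a₁ a₂
  have c13 := cos_angle_mul_norm_mul_norm a₁ a₃
  have c23 := cos_angle_mul_norm_mul_norm a₂ a₃
  have x1 := ex a₁
  have x2 := ex a₂
  have x3 := ex a₃
  rw [i1, real_inner_self_eq_norm_sq] at x1
  rw [i2, real_inner_self_eq_norm_sq, real_inner_comm] at x2
  rw [i3, real_inner_self_eq_norm_sq, real_inner_comm, real_inner_comm a₂ a₃] at x3
  have := arccos_sum_le (x := (1 - l) / 2) (a := cos (angle a₂ a₃)) (b := cos (angle a₁ a₃))
    (c := cos (angle a₁ a₂)) (by linarith) (by linarith) p1 p2 p3 (abs_cos_le_one _)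
    (abs_cos_le_one _) (abs_cos_le_one _) ?_ ?_ ?_
  · rw [arccos_cos (angle_nonneg _ _) (angle_le_pi _ _),
      arccos_cos (angle_nonneg _ _) (angle_le_pi _ _),
      arccos_cos (angle_nonneg _ _) (angle_le_pi _ _)] at this
    convert this using 3; ring
  · apply mul_left_cancel₀ p1.ne'; linear_combination -x1 - c12 - c13
  · apply mul_left_cancel₀ p2.ne'; linear_combination -x2 - c12 - c23
  · apply mul_left_cancel₀ p3.ne'; linear_combination -x3 - c13 - c23
end


lemma mul_le_mul_of_additive {f : ℝ → ℝ} {c : ℝ} (hc : 0 < c) (hf : ∀ s, 0 ≤ s → s ≤ c → 0 ≤ f s)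
    (hadd : ∀ s t, 0 ≤ s → 0 ≤ t → s + t ≤ c → f (s + t) = f s + f t) {t : ℝ} (ht : 0 ≤ t)
    (htc : t ≤ c) : f t * c ≤ t * f c := by
  have hmul : ∀ (k : ℕ) (s : ℝ), 0 ≤ s → k * s ≤ c → f (k * s) = k * f s := by
    intro k s hs
    induction k with
    | zero =>
      intro _
      have := hadd 0 0 le_rfl le_rfl (by simpa using hc.le)
      simp at this ⊢; exact this
    | succ k ih =>
      intro h
      push_cast at h ⊢
      rw [add_mul, one_mul] at h ⊢
      rw [hadd _ _ (by positivity) hs h, ih (by linarith)]; ring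
  have hmono : ∀ s t, 0 ≤ s → s ≤ t → t ≤ c → f s ≤ f t := by
    intro s t hs hst ht
    have := hadd s (t - s) hs (by linarith) (by linarith)
    rw [add_sub_cancel] at this
    linarith [hf (t - s) (by linarith) (by linarith)]
  have hn : ∀ n : ℕ, (f t * c - t * f c) * n ≤ c * f c := by
    intro n
    rcases Nat.eq_zero_or_pos n with rfl | hn
    · simpa using mul_nonneg hc.le (hf c hc.le le_rfl)
    have hn' : (0 : ℝ) < n := by exact_mod_cast hn
    have hfc : f c = n * f (c / n) := by
      rw [← hmul n (c / n) (by positivity) (by rw [mul_div_cancel₀ _ hn'.ne']),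
        mul_div_cancel₀ _ hn'.ne']
    set k := ⌈t * n / c⌉₊
    have hkn : (k : ℝ) ≤ n := by
      have : k ≤ n := Nat.ceil_le.2 (by rw [div_le_iff₀ hc]; nlinarith)
      exact_mod_cast this
    have hk1 : t * n / c ≤ k := Nat.le_ceil _
    have hk2 : (k : ℝ) < t * n / c + 1 := Nat.ceil_lt_add_one (by positivity)
    have hkc : k * (c / n) ≤ c := by
      rw [← mul_div_assoc, div_le_iff₀ hn']; nlinarith
    have hft : f t ≤ k * f (c / n) := by
      rw [← hmul k _ (by positivity) hkc]
      refine hmono _ _ ht ?_ hkc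
      rw [← mul_div_assoc, le_div_iff₀ hn']
      rwa [div_le_iff₀ hc] at hk1
    have hk3 : k * c ≤ t * n + c := by
      have := mul_lt_mul_of_pos_right hk2 hc
      rw [add_mul, div_mul_cancel₀ _ hc.ne'] at this; linarith
    have hpos : 0 ≤ f (c / n) :=
      hf _ (by positivity) (div_le_self hc.le (by exact_mod_cast hn))
    rw [hfc]
    have e1 : f t * c * n ≤ k * f (c / n) * c * n := by gcongr
    have e2 : k * c * (f (c / n) * n) ≤ (t * n + c) * (f (c / n) * n) := by gcongr
    linarith
  by_contra! h
  obtain ⟨n, hn'⟩ := exists_nat_gt (c * f c / (f t * c - t * f c))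
  rw [div_lt_iff₀ (by linarith)] at hn'
  linarith [hn n]

section
variable {F : Type*} [NormedAddCommGroup F] [InnerProductSpace ℝ F]

/-- The vectors `x` whose inner products with `a` and with `b` have strictly opposite signs. -/
def signDisagree (a b : F) : Set F := {x | inner ℝ a x * inner ℝ b x < 0}

lemma signDisagree_comm (a b : F) : signDisagree a b = signDisagree b a := by
  simp [signDisagree, mul_comm]

lemma signDisagree_smul (a b : F) {r s : ℝ} (hr : 0 < r) (hs : 0 < s) :
    signDisagree (r • a) (s • b) = signDisagree a b := by
  ext x
  simp only [signDisagree, Set.mem_ofPred_eq, real_inner_smul_left]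
  rw [show r * inner ℝ a x * (s * inner ℝ b x) = (r * s) * (inner ℝ a x * inner ℝ b x) by ring]
  exact ⟨fun h ↦ (pos_iff_neg_of_mul_neg h).1 (mul_pos hr hs), mul_neg_of_pos_of_neg (mul_pos hr hs)⟩

lemma isOpen_signDisagree (a b : F) : IsOpen (signDisagree a b) :=
  isOpen_lt (by fun_prop) continuous_const

/-- The point at angle `t` on the unit circle of the plane with orthonormal frame `e, f`. -/
noncomputable def circlePoint (e f : F) (t : ℝ) : F := cos t • e + sin t • f

lemma inner_circlePoint {e f : F} (he : ‖e‖ = 1) (hf : ‖f‖ = 1) (hef : inner ℝ e f = 0) (s t : ℝ) :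
    inner ℝ (circlePoint e f s) (circlePoint e f t) = cos (s - t) := by
  simp only [circlePoint, inner_add_left, inner_add_right, real_inner_smul_left,
    real_inner_smul_right, real_inner_self_eq_norm_sq, he, hf, hef, real_inner_comm e f, cos_sub]
  ring

lemma reflection_circlePoint {e f : F} (he : ‖e‖ = 1) (hf : ‖f‖ = 1) (hef : inner ℝ e f = 0)
    (s t : ℝ) : (ℝ ∙ circlePoint e f s).reflection (circlePoint e f t)
      = circlePoint e f (2 * s - t) := by
  have hn : ‖circlePoint e f s‖ ^ 2 = 1 := by
    rw [← real_inner_self_eq_norm_sq, inner_circlePoint he hf hef]; simp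
  rw [Submodule.reflection_singleton_apply, inner_circlePoint he hf hef, RCLike.ofReal_real_eq_id,
    id, hn, div_one]
  simp only [circlePoint]
  have h1 : cos (2 * s - t) = 2 * cos (s - t) * cos s - cos t := by
    have := cos_add_cos (2 * s - t) t
    rw [show (2 * s - t + t) / 2 = s by ring, show (2 * s - t - t) / 2 = s - t by ring] at this
    linarith
  have h2 : sin (2 * s - t) = 2 * cos (s - t) * sin s - sin t := by
    have := sin_add_sin (2 * s - t) t
    rw [show (2 * s - t + t) / 2 = s by ring, show (2 * s - t - t) / 2 = s - t by ring] at this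
    linarith
  rw [h1, h2]
  module

variable [MeasurableSpace F] [BorelSpace F]

lemma measureReal_signDisagree_circlePoint {μ : Measure F}
    (hμ : ∀ T : F ≃ₗᵢ[ℝ] F, MeasurePreserving T μ μ)
    {e f : F} (he : ‖e‖ = 1) (hf : ‖f‖ = 1) (hef : inner ℝ e f = 0) (s t : ℝ) :
    μ.real (signDisagree (circlePoint e f s) (circlePoint e f t)) =
      μ.real (signDisagree (circlePoint e f 0) (circlePoint e f (t - s))) := by
  set T := (ℝ ∙ circlePoint e f (t / 2)).reflection with hT
  have hs : T (circlePoint e f s) = circlePoint e f (t - s) := by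
    rw [hT, reflection_circlePoint he hf hef]; congr 1; ring
  have ht : T (circlePoint e f t) = circlePoint e f 0 := by
    rw [hT, reflection_circlePoint he hf hef]; congr 1; ring
  rw [signDisagree_comm (circlePoint e f 0), ← hs, ← ht,
    ← (hμ T).measureReal_preimage (isOpen_signDisagree _ _).measurableSet.nullMeasurableSet]
  congr 1
  ext x
  have hT' : ∀ v, inner ℝ v (T x) = inner ℝ (T v) x := fun v ↦ by
    rw [← T.inner_map_map, hT, Submodule.reflection_reflection]
  simp only [signDisagree, Set.preimage_ofPred_eq, Set.mem_ofPred_eq, hT']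

/-- For a finite rotation-invariant measure that does not charge hyperplanes, the proportion of
vectors separated by `a` and `b` is at most their angle divided by `π`. -/
lemma measureReal_signDisagree_le {μ : Measure F} [IsFiniteMeasure μ]
    (hμ : ∀ T : F ≃ₗᵢ[ℝ] F, MeasurePreserving T μ μ)
    (hμ0 : ∀ a : F, a ≠ 0 → μ {x | inner ℝ a x = 0} = 0) {a b : F} (ha : a ≠ 0) (hb : b ≠ 0) :
    μ.real (signDisagree a b) * π ≤ angle a b * μ.real Set.univ := by
  have hna : 0 < ‖a‖ := norm_pos_iff.2 ha
  have hnb : 0 < ‖b‖ := norm_pos_iff.2 hb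
  by_cases h0 : angle a b = 0
  · obtain ⟨-, r, hr, rfl⟩ := angle_eq_zero_iff.1 h0
    have : signDisagree a (r • a) = ∅ := by
      ext x
      simp only [signDisagree, real_inner_smul_left, Set.mem_ofPred_eq, Set.mem_empty_iff_false,
        iff_false, not_lt]
      nlinarith [mul_nonneg hr.le (mul_self_nonneg (inner ℝ a x))]
    simp [this, h0]
  by_cases hpi : angle a b = π
  · rw [hpi, mul_comm]
    exact mul_le_mul_of_nonneg_left (measureReal_mono (Set.subset_univ _)) pi_pos.le
  have hs : 0 < sin (angle a b) := sin_pos_of_pos_of_lt_pi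
    (lt_of_le_of_ne (angle_nonneg _ _) (Ne.symm h0)) (lt_of_le_of_ne (angle_le_pi _ _) hpi)
  set θ := angle a b with hθ
  set e : F := ‖a‖⁻¹ • a with he_def
  set b' : F := ‖b‖⁻¹ • b with hb'_def
  set f : F := (sin θ)⁻¹ • (b' - cos θ • e) with hf_def
  have he : ‖e‖ = 1 := by rw [he_def, norm_smul, norm_inv, norm_norm, inv_mul_cancel₀ hna.ne']
  have hb' : ‖b'‖ = 1 := by rw [hb'_def, norm_smul, norm_inv, norm_norm, inv_mul_cancel₀ hnb.ne']
  have heb : inner ℝ e b' = cos θ := by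
    rw [hθ, cos_angle, he_def, hb'_def, real_inner_smul_left, real_inner_smul_right]
    field_simp
  clear_value e b'
  have hef : inner ℝ e f = 0 := by
    rw [hf_def, real_inner_smul_right, inner_sub_right, real_inner_smul_right,
      real_inner_self_eq_norm_sq, he, heb]; ring
  have hf : ‖f‖ = 1 := by
    have h1 : ‖b' - cos θ • e‖ ^ 2 = sin θ ^ 2 := by
      rw [norm_sub_sq_real, hb', norm_smul, he, real_inner_smul_right, real_inner_comm, heb,
        sin_sq, Real.norm_eq_abs, mul_one, sq_abs]
      ring
    have h2 : ‖b' - cos θ • e‖ = sin θ := by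
      rwa [sq_eq_sq₀ (norm_nonneg _) hs.le] at h1
    rw [hf_def, norm_smul, h2, norm_inv, Real.norm_eq_abs, abs_of_pos hs, inv_mul_cancel₀ hs.ne']
  have hc0 : circlePoint e f 0 = e := by simp [circlePoint]
  have hcθ : circlePoint e f θ = b' := by
    rw [circlePoint, hf_def, smul_smul, mul_inv_cancel₀ hs.ne']; module
  have hD : signDisagree a b = signDisagree (circlePoint e f 0) (circlePoint e f θ) := by
    rw [hc0, hcθ, he_def, hb'_def, signDisagree_smul _ _ (inv_pos.2 hna) (inv_pos.2 hnb)]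
  set g : ℝ → ℝ := fun t ↦ μ.real (signDisagree (circlePoint e f 0) (circlePoint e f t)) with hg
  have hadd : ∀ s t, 0 ≤ s → 0 ≤ t → s + t ≤ π → g (s + t) = g s + g t := by
    intro s t hs ht hst
    have h2 : g t = μ.real (signDisagree (circlePoint e f s) (circlePoint e f (s + t))) := by
      rw [measureReal_signDisagree_circlePoint hμ he hf hef, add_sub_cancel_left]
    have hcomb : ∀ x, sin (s + t) * inner ℝ (circlePoint e f s) x =
        sin t * inner ℝ (circlePoint e f 0) x + sin s * inner ℝ (circlePoint e f (s + t)) x := by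
      intro x
      simp only [circlePoint, inner_add_left, real_inner_smul_left, sin_add, cos_add, cos_zero,
        sin_zero]
      linear_combination (sin t * inner ℝ e x) * sin_sq_add_cos_sq s
    have hg0 : g 0 = 0 := by
      have : signDisagree (circlePoint e f 0) (circlePoint e f 0) = ∅ := by
        ext x
        simp [signDisagree, mul_self_nonneg]
      simp only [hg, this, measureReal_empty]
    rcases hs.eq_or_lt with rfl | hs'
    · simp [hg0]
    rcases ht.eq_or_lt with rfl | ht'
    · simp [hg0]
    have hsin1 := sin_pos_of_pos_of_lt_pi hs' (by linarith)
    have hsin2 := sin_pos_of_pos_of_lt_pi ht' (by linarith)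
    have hsin3 := sin_nonneg_of_nonneg_of_le_pi (add_nonneg hs ht) hst
    have hne : circlePoint e f s ≠ 0 := by
      intro h
      have := inner_circlePoint he hf hef s s
      simp [h] at this
    rw [h2]
    simp only [hg]
    rw [← measureReal_union _ (isOpen_signDisagree _ _).measurableSet]
    · refine measureReal_congr ?_
      have hae : ∀ᵐ x ∂μ, inner ℝ (circlePoint e f s) x ≠ 0 := by
        rw [ae_iff]; simpa using hμ0 _ hne
      filter_upwards [hae] with x hx
      refine propext ?_
      change inner ℝ (circlePoint e f 0) x * inner ℝ (circlePoint e f (s + t)) x < 0 ↔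
        inner ℝ (circlePoint e f 0) x * inner ℝ (circlePoint e f s) x < 0 ∨
        inner ℝ (circlePoint e f s) x * inner ℝ (circlePoint e f (s + t)) x < 0
      have hc := hcomb x
      generalize inner ℝ (circlePoint e f 0) x = u at *
      generalize inner ℝ (circlePoint e f s) x = w at *
      generalize inner ℝ (circlePoint e f (s + t)) x = y at *
      constructor
      · intro h
        by_contra! hcon
        nlinarith [mul_nonneg hcon.1 hcon.2, mul_pos_of_neg_of_neg h
          (neg_neg_of_pos (sq_pos_of_ne_zero hx))]
      · rintro (h | h)
        · have hu : u ≠ 0 := by rintro rfl; simp at h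
          have h1 : sin s * (u * y) = sin (s + t) * (u * w) - sin t * u ^ 2 := by
            linear_combination (-u) * hc
          have h2 : sin s * (u * y) < 0 := by
            rw [h1]
            nlinarith [mul_nonpos_of_nonneg_of_nonpos hsin3 h.le,
              mul_pos hsin2 (sq_pos_of_ne_zero hu)]
          exact (pos_iff_neg_of_mul_neg h2).1 hsin1
        · have hy : y ≠ 0 := by rintro rfl; simp at h
          have h1 : sin t * (u * y) = sin (s + t) * (w * y) - sin s * y ^ 2 := by
            linear_combination (-y) * hc
          have h2 : sin t * (u * y) < 0 := by
            rw [h1]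
            nlinarith [mul_nonpos_of_nonneg_of_nonpos hsin3 h.le,
              mul_pos hsin1 (sq_pos_of_ne_zero hy)]
          exact (pos_iff_neg_of_mul_neg h2).1 hsin2
    · rw [Set.disjoint_left]
      intro x h1 h2
      simp only [signDisagree, Set.mem_ofPred_eq] at h1 h2
      have hc : sin (s + t) * inner ℝ (circlePoint e f s) x ^ 2 =
          sin t * (inner ℝ (circlePoint e f 0) x * inner ℝ (circlePoint e f s) x) +
          sin s * (inner ℝ (circlePoint e f s) x * inner ℝ (circlePoint e f (s + t)) x) := by
        linear_combination (inner ℝ (circlePoint e f s) x) * hcomb x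
      linarith [mul_neg_of_pos_of_neg hsin2 h1, mul_neg_of_pos_of_neg hsin1 h2,
        mul_nonneg hsin3 (sq_nonneg (inner ℝ (circlePoint e f s) x))]
  have := mul_le_mul_of_additive pi_pos (f := g) (fun _ _ _ ↦ measureReal_nonneg) hadd
    (angle_nonneg a b) (angle_le_pi a b)
  rw [hD]
  refine this.trans ?_
  exact mul_le_mul_of_nonneg_left (measureReal_mono (Set.subset_univ _)) (angle_nonneg a b)
variable [FiniteDimensional ℝ F]

open Classical in
/-- Some vector, orthogonal to none of the `a i`, separates at most the expected number of the pairs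
`a i, b i` for a random direction. -/
lemma exists_sum_signDisagree_le {ι : Type*} [Fintype ι] (a b : ι → F) (ha : ∀ i, a i ≠ 0)
    (hb : ∀ i, b i ≠ 0) :
    ∃ x : F, (∀ i, inner ℝ (a i) x ≠ 0) ∧
      (∑ i, if inner ℝ (a i) x * inner ℝ (b i) x < 0 then (1 : ℝ) else 0) * π
        ≤ ∑ i, angle (a i) (b i) := by
  set μ : Measure F := volume.restrict (Metric.ball 0 1) with hμdef
  have hfin : IsFiniteMeasure μ := ⟨by
    rw [hμdef, Measure.restrict_apply_univ]; exact measure_ball_lt_top⟩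
  have hinv : ∀ T : F ≃ₗᵢ[ℝ] F, MeasurePreserving T μ μ := fun T ↦ by
    have := T.measurePreserving.restrict_preimage
      (Metric.isOpen_ball (x := (0 : F)) (ε := 1)).measurableSet
    rwa [T.preimage_ball, map_zero] at this
  have hnull : ∀ a : F, a ≠ 0 → μ {x | inner ℝ a x = 0} = 0 := by
    intro a ha
    refine Measure.restrict_le_self.absolutelyContinuous ?_
    have hset : {x | inner ℝ a x = 0} = (((ℝ ∙ a)ᗮ : Submodule ℝ F) : Set F) := by
      ext x
      simp [Submodule.mem_orthogonal_singleton_iff_inner_right]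
    rw [hset]
    refine Measure.addHaar_submodule _ _ fun h ↦ ha ?_
    rwa [Submodule.orthogonal_eq_top_iff, Submodule.span_singleton_eq_bot] at h
  have huniv : μ Set.univ ≠ 0 := by
    rw [hμdef, Measure.restrict_apply_univ]
    exact (Metric.measure_ball_pos _ _ one_pos).ne'
  have hμne : μ ≠ 0 := fun h ↦ huniv (by simp [h])
  have hM : 0 < μ.real Set.univ := ENNReal.toReal_pos huniv (measure_ne_top _ _)
  have hmeas := fun i ↦ (isOpen_signDisagree (a i) (b i)).measurableSet
  have hint : ∀ i, Integrable ((signDisagree (a i) (b i)).indicator (fun _ ↦ (1 : ℝ))) μ :=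
    fun i ↦ (integrable_const 1).indicator (hmeas i)
  have hnull' : μ (⋃ i, {x | inner ℝ (a i) x = 0}) = 0 :=
    measure_iUnion_null fun i ↦ hnull _ (ha i)
  obtain ⟨x, hx, hle⟩ := exists_notMem_null_le_average hμne
    (integrable_finsetSum Finset.univ fun i _ ↦ hint i) hnull'
  refine ⟨x, by simpa using hx, ?_⟩
  have hsum : (∑ i, if inner ℝ (a i) x * inner ℝ (b i) x < 0 then (1 : ℝ) else 0)
      = ∑ i, (signDisagree (a i) (b i)).indicator (fun _ ↦ (1 : ℝ)) x := by
    refine Finset.sum_congr rfl fun i _ ↦ ?_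
    simp [Set.indicator_apply, signDisagree]
  rw [average_eq, integral_finsetSum _ fun i _ ↦ hint i, smul_eq_mul, inv_mul_eq_div,
    le_div_iff₀ hM] at hle
  rw [hsum]
  refine le_of_mul_le_mul_right ?_ hM
  calc _ = (∑ i, (signDisagree (a i) (b i)).indicator (fun _ ↦ (1 : ℝ)) x)
          * μ.real Set.univ * π := by ring
    _ ≤ (∑ i, ∫ y, (signDisagree (a i) (b i)).indicator (fun _ ↦ (1 : ℝ)) y ∂μ) * π := by
      gcongr
    _ = ∑ i, μ.real (signDisagree (a i) (b i)) * π := by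
      rw [Finset.sum_mul]
      refine Finset.sum_congr rfl fun i _ ↦ ?_
      rw [integral_indicator_const _ (hmeas i), smul_eq_mul, mul_one]
    _ ≤ ∑ i, angle (a i) (b i) * μ.real Set.univ :=
      Finset.sum_le_sum fun i _ ↦ measureReal_signDisagree_le hinv hnull (ha i) (hb i)
    _ = _ := by rw [Finset.sum_mul]
end

section
variable {V : Type*} [Fintype V]

/-- The eigenspace of the adjacency matrix of `G` at `l`, inside Euclidean space. -/
def adjEigenspace (G : SimpleGraph V) [DecidableRel G.Adj] (l : ℝ) :
    Submodule ℝ (EuclideanSpace ℝ V) where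
  carrier := {y | ∀ v, ∑ u ∈ G.neighborFinset v, y u = l * y v}
  add_mem' {x y} hx hy v := by
    simp only [PiLp.add_apply, Finset.sum_add_distrib, hx v, hy v, mul_add]
  zero_mem' v := by simp
  smul_mem' c x hx v := by
    simp only [PiLp.smul_apply, smul_eq_mul, ← Finset.mul_sum, hx v]; ring

variable {G : SimpleGraph V} [DecidableRel G.Adj] {l : ℝ}

lemma mem_adjEigenspace {y : EuclideanSpace ℝ V} :
    y ∈ adjEigenspace G l ↔ ∀ v, ∑ u ∈ G.neighborFinset v, y u = l * y v := Iff.rfl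

lemma adjMatrix_mulVec_eq_iff {x : V → ℝ} :
    G.adjMatrix ℝ *ᵥ x = l • x ↔ WithLp.toLp 2 x ∈ adjEigenspace G l := by
  simp [funext_iff, mem_adjEigenspace, SimpleGraph.adjMatrix_mulVec_apply]

variable [DecidableEq V]

variable (G l) in
/-- The orthogonal projection of the standard basis vector at `v` to the eigenspace at `l`. -/
noncomputable def eigenProj (v : V) : EuclideanSpace ℝ V :=
  (adjEigenspace G l).starProjection (EuclideanSpace.single v 1)

lemma eigenProj_mem (v : V) : eigenProj G l v ∈ adjEigenspace G l :=
  Submodule.starProjection_apply_mem _ _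

lemma inner_eigenProj (v : V) {y : EuclideanSpace ℝ V} (hy : y ∈ adjEigenspace G l) :
    inner ℝ (eigenProj G l v) y = y v := by
  have := Submodule.starProjection_inner_eq_zero (K := adjEigenspace G l)
    (EuclideanSpace.single v 1) y hy
  rw [inner_sub_left, sub_eq_zero] at this
  rw [eigenProj, ← this]
  simp [EuclideanSpace.inner_single_left]

lemma sum_eigenProj (v : V) :
    ∑ u ∈ G.neighborFinset v, eigenProj G l u = l • eigenProj G l v := by
  set d := ∑ u ∈ G.neighborFinset v, eigenProj G l u - l • eigenProj G l v with hd
  have hmem : d ∈ adjEigenspace G l :=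
    sub_mem (sum_mem fun u _ ↦ eigenProj_mem u) (Submodule.smul_mem _ _ (eigenProj_mem v))
  rw [← sub_eq_zero, ← hd, ← inner_self_eq_zero (𝕜 := ℝ)]
  nth_rw 1 [hd]
  rw [inner_sub_left, sum_inner, real_inner_smul_left, inner_eigenProj v hmem, ← hmem v, sub_eq_zero]
  exact Finset.sum_congr rfl fun u _ ↦ inner_eigenProj u hmem

lemma norm_eigenProj_apply_le (φ : G ≃g G) (v : V) :
    ‖eigenProj G l (φ v)‖ ≤ ‖eigenProj G l v‖ := by
  set y : EuclideanSpace ℝ V := WithLp.toLp 2 fun u ↦ eigenProj G l (φ v) (φ u) with hy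
  have hmem : y ∈ adjEigenspace G l := by
    intro w
    rw [show y w = eigenProj G l (φ v) (φ w) from rfl, ← eigenProj_mem (φ v) (φ w)]
    refine Finset.sum_bij (fun u _ ↦ φ u) (fun u hu ↦ ?_) (fun _ _ _ _ h ↦ φ.injective h)
      (fun u hu ↦ ⟨φ.symm u, ?_, by simp⟩) (fun _ _ ↦ rfl)
    · simpa [φ.map_adj_iff] using hu
    · rw [SimpleGraph.mem_neighborFinset] at hu ⊢
      rw [← φ.map_adj_iff]; simpa using hu
  have hnorm : ‖y‖ = ‖eigenProj G l (φ v)‖ := by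
    rw [EuclideanSpace.norm_eq, EuclideanSpace.norm_eq]
    congr 1
    exact Equiv.sum_comp φ.toEquiv (fun u ↦ ‖eigenProj G l (φ v) u‖ ^ 2)
  have h1 : ‖eigenProj G l (φ v)‖ ^ 2 = y v := by
    rw [← real_inner_self_eq_norm_sq, inner_eigenProj _ (eigenProj_mem _)]
  have h2 : y v ≤ ‖eigenProj G l v‖ * ‖eigenProj G l (φ v)‖ := by
    rw [← inner_eigenProj v hmem, ← hnorm]; exact real_inner_le_norm _ _
  rcases (norm_nonneg (eigenProj G l (φ v))).eq_or_lt with h | h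
  · rw [← h]; exact norm_nonneg _
  · refine le_of_mul_le_mul_right ?_ h
    rw [← sq, h1]; exact h2

lemma norm_eigenProj_eq (htrans : ∀ u v : V, ∃ φ : G ≃g G, φ u = v) (u v : V) :
    ‖eigenProj G l u‖ = ‖eigenProj G l v‖ := by
  obtain ⟨φ, rfl⟩ := htrans v u
  obtain ⟨ψ, hψ⟩ := htrans (φ v) v
  refine le_antisymm (norm_eigenProj_apply_le φ v) ?_
  simpa [hψ] using norm_eigenProj_apply_le (l := l) ψ (φ v)

lemma posSemidef_adjMatrix_sub
    (hl : l ∈ lowerBounds {μ : ℝ | ∃ x : V → ℝ, x ≠ 0 ∧ G.adjMatrix ℝ *ᵥ x = μ • x}) :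
    (G.adjMatrix ℝ - l • (1 : Matrix V V ℝ)).PosSemidef := by
  have hB : (G.adjMatrix ℝ - l • (1 : Matrix V V ℝ)).IsHermitian := by
    rw [Matrix.IsHermitian, conjTranspose_eq_transpose_of_trivial]
    simp
  rw [hB.posSemidef_iff_eigenvalues_nonneg]
  intro i
  have h := hB.mulVec_eigenvectorBasis i
  rw [sub_mulVec, smul_mulVec, one_mulVec, sub_eq_iff_eq_add, ← add_smul] at h
  have := hl ⟨_, ?_, h⟩
  · simpa using this
  · intro h0
    exact hB.eigenvectorBasis.orthonormal.ne_zero i ((WithLp.ofLp_eq_zero 2).1 h0)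

lemma edge_quadratic_form {u v : V} (h : G.Adj u v) :
    star (Pi.single u 1 - Pi.single v 1 : V → ℝ) ⬝ᵥ
      ((G.adjMatrix ℝ - l • (1 : Matrix V V ℝ)) *ᵥ (Pi.single u 1 - Pi.single v 1 : V → ℝ))
      = -2 - 2 * l := by
  have h1 : G.Adj v u := h.symm
  have h2 : u ≠ v := h.ne
  simp [mulVec_sub, sub_dotProduct, dotProduct_sub, h, h1, h2, h2.symm]
  ring

lemma le_neg_one_of_adj
    (hl : l ∈ lowerBounds {μ : ℝ | ∃ x : V → ℝ, x ≠ 0 ∧ G.adjMatrix ℝ *ᵥ x = μ • x})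
    {u v : V} (h : G.Adj u v) : l ≤ -1 := by
  have := (posSemidef_adjMatrix_sub hl).dotProduct_mulVec_nonneg (Pi.single u 1 - Pi.single v 1)
  rw [edge_quadratic_form h] at this
  linarith

lemma eigenProj_ne_zero (htrans : ∀ u v : V, ∃ φ : G ≃g G, φ u = v) {x : V → ℝ} (hx : x ≠ 0)
    (hxl : G.adjMatrix ℝ *ᵥ x = l • x) (v : V) : eigenProj G l v ≠ 0 := by
  obtain ⟨w, hw⟩ := Function.ne_iff.1 hx
  rw [← norm_ne_zero_iff, norm_eigenProj_eq htrans v w, norm_ne_zero_iff]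
  intro h0
  have := inner_eigenProj w (adjMatrix_mulVec_eq_iff.1 hxl)
  rw [h0, inner_zero_left] at this
  exact hw this.symm

lemma eigenProj_ne_of_adj (hreg : G.IsRegularOfDegree 3)
    (htrans : ∀ u v : V, ∃ φ : G ≃g G, φ u = v)
    (hl : IsLeast {μ : ℝ | ∃ x : V → ℝ, x ≠ 0 ∧ G.adjMatrix ℝ *ᵥ x = μ • x} l)
    {u v : V} (h : G.Adj v u) : eigenProj G l v ≠ eigenProj G l u := by
  intro heq
  have hl1 := le_neg_one_of_adj hl.2 h
  obtain ⟨x, hx, hxl⟩ := hl.1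
  have hpos : 0 < ‖eigenProj G l v‖ := norm_pos_iff.2 (eigenProj_ne_zero htrans hx hxl v)
  have hu : u ∈ G.neighborFinset v := by simpa using h
  have hsum := sum_eigenProj (G := G) (l := l) v
  rw [← Finset.add_sum_erase _ _ hu, ← heq] at hsum
  have hbound : ‖∑ w ∈ (G.neighborFinset v).erase u, eigenProj G l w‖ ≤ 2 * ‖eigenProj G l v‖ := by
    refine (norm_sum_le _ _).trans ?_
    rw [Finset.sum_congr rfl fun w _ ↦ norm_eigenProj_eq htrans w v, Finset.sum_const,
      Finset.card_erase_of_mem hu, SimpleGraph.card_neighborFinset_eq_degree, hreg v]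
    simp
  have hsub : ∑ w ∈ (G.neighborFinset v).erase u, eigenProj G l w = (l - 1) • eigenProj G l v := by
    rw [sub_smul, one_smul, ← hsum]; abel
  rw [hsub, norm_smul, Real.norm_eq_abs] at hbound
  have hl2 := le_of_mul_le_mul_right hbound hpos
  have hl3 : l = -1 := by linarith [neg_abs_le (l - 1)]
  have hker := ((posSemidef_adjMatrix_sub hl.2).dotProduct_mulVec_zero_iff _).1
    ((edge_quadratic_form h).trans (by rw [hl3]; norm_num))
  rw [sub_mulVec, smul_mulVec, one_mulVec, sub_eq_zero, adjMatrix_mulVec_eq_iff] at hker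
  have h1 := inner_eigenProj v hker
  have h2 := inner_eigenProj u hker
  rw [heq, h2] at h1
  simp [h.ne, h.ne.symm] at h1
  norm_num at h1

lemma two_le_sum_sign_changes {s₀ s₁ s₂ : ℝ} (h₀ : s₀ ≠ 0) (h₁ : s₁ ≠ 0) (h₂ : s₂ ≠ 0)
    (hpos : ¬ (0 < s₀ ∧ 0 < s₁ ∧ 0 < s₂)) (hneg : ¬ (s₀ < 0 ∧ s₁ < 0 ∧ s₂ < 0)) :
    (2 : ℝ) ≤ (if s₀ * s₁ < 0 then 1 else 0) + (if s₁ * s₂ < 0 then 1 else 0)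
      + (if s₂ * s₀ < 0 then 1 else 0) := by
  rcases h₀.lt_or_gt with h₀ | h₀ <;> rcases h₁.lt_or_gt with h₁ | h₁ <;>
    rcases h₂.lt_or_gt with h₂ | h₂ <;>
    first
    | (exfalso; tauto)
    | norm_num [mul_neg_iff, h₀, h₁, h₂, h₀.not_gt, h₁.not_gt, h₂.not_gt]

lemma angle_sum_neighbors_le (hreg : G.IsRegularOfDegree 3)
    (htrans : ∀ u v : V, ∃ φ : G ≃g G, φ u = v)
    (hl : IsLeast {μ : ℝ | ∃ x : V → ℝ, x ≠ 0 ∧ G.adjMatrix ℝ *ᵥ x = μ • x} l) (v : V)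
    (e : Fin 3 ≃ G.neighborFinset v) :
    ∑ k, angle (eigenProj G l v - eigenProj G l (e k))
      (eigenProj G l v - eigenProj G l (e (k + 1))) ≤ 3 * arccos ((1 - l) / 4) := by
  have hadj : ∀ k, G.Adj v (e k) := fun k ↦
    (SimpleGraph.mem_neighborFinset _ _ _).1 (e k).2
  have hsum : eigenProj G l (e 0) + eigenProj G l (e 1) + eigenProj G l (e 2)
      = l • eigenProj G l v := by
    rw [← sum_eigenProj, ← Finset.sum_coe_sort, ← Equiv.sum_comp e, Fin.sum_univ_three]
  have hne := fun k ↦ eigenProj_ne_of_adj hreg htrans hl (hadj k)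
  have := angle_sum_le (norm_eigenProj_eq htrans (e 0 : V) v) (norm_eigenProj_eq htrans (e 1 : V) v)
    (norm_eigenProj_eq htrans (e 2 : V) v) (hne 0) (hne 1) (hne 2)
    (le_neg_one_of_adj hl.2 (hadj 0)) hsum
  rw [Fin.sum_univ_three, show (0 + 1 : Fin 3) = 1 from rfl, show (1 + 1 : Fin 3) = 2 from rfl,
    show (2 + 1 : Fin 3) = 0 from rfl,
    angle_comm (eigenProj G l v - eigenProj G l (e 2))]
  linarith

end

/-- A finite, `3`-regular, vertex-transitive simple graph with
least adjacency-matrix eigenvalue `lam` contains two disjoint independent sets `I₁, I₂`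
with `|I₁ ∪ I₂| ≥ 2·q₃(lam)·|V|`; in particular the induced subgraph on `I₁ ∪ I₂`
is bipartite (being the union of two disjoint independent sets it is `2`-colorable). -/
theorem two_disjoint_independent_sets_of_cubic_vertex_transitive
    {V : Type*} [Fintype V] [DecidableEq V] (G : SimpleGraph V) [DecidableRel G.Adj]
    (hreg : G.IsRegularOfDegree 3)
    (htrans : ∀ u v : V, ∃ φ : G ≃g G, φ u = v)
    (lam : ℝ)
    (hlam : IsLeast {μ : ℝ | ∃ x : V → ℝ, x ≠ 0 ∧ G.adjMatrix ℝ *ᵥ x = μ • x} lam) :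
    ∃ I₁ I₂ : Finset V,
      (∀ u ∈ I₁, ∀ v ∈ I₁, ¬ G.Adj u v) ∧
      (∀ u ∈ I₂, ∀ v ∈ I₂, ¬ G.Adj u v) ∧
      Disjoint I₁ I₂ ∧
      2 * (1 / 2 - (3 / (4 * Real.pi)) * Real.arccos ((1 - lam) / 4)) * (Fintype.card V : ℝ)
        ≤ ((I₁ ∪ I₂).card : ℝ) := by
  classical
  have hcard : ∀ v, (G.neighborFinset v).card = 3 := fun v ↦ by
    rw [SimpleGraph.card_neighborFinset_eq_degree, hreg v]
  let e : ∀ v, Fin 3 ≃ G.neighborFinset v := fun v ↦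
    ((G.neighborFinset v).equivFinOfCardEq (hcard v)).symm
  have hadj : ∀ v k, G.Adj v (e v k) := fun v k ↦
    (SimpleGraph.mem_neighborFinset _ _ _).1 (e v k).2
  have hidx : ∀ {v u}, G.Adj v u → ∃ k, (e v k : V) = u := fun {v u} h ↦
    ⟨(e v).symm ⟨u, by simpa using h⟩, by simp⟩
  let d : V → Fin 3 → EuclideanSpace ℝ V := fun v k ↦ eigenProj G lam v - eigenProj G lam (e v k)
  have hd : ∀ v k, d v k ≠ 0 := fun v k ↦
    sub_ne_zero.2 (eigenProj_ne_of_adj hreg htrans hlam (hadj v k))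
  obtain ⟨x, hx, hle⟩ := exists_sum_signDisagree_le (fun p : V × Fin 3 ↦ d p.1 p.2)
    (fun p ↦ d p.1 (p.2 + 1)) (fun p ↦ hd _ _) (fun p ↦ hd _ _)
  rw [Fintype.sum_prod_type, Fintype.sum_prod_type] at hle
  have hangle : ∑ v, ∑ k, angle (d v k) (d v (k + 1))
      ≤ ∑ _v : V, 3 * arccos ((1 - lam) / 4) :=
    Finset.sum_le_sum fun v _ ↦ angle_sum_neighbors_le hreg htrans hlam v (e v)
  let I₁ : Finset V := {v | ∀ k, 0 < inner ℝ (d v k) x}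
  let I₂ : Finset V := {v | ∀ k, inner ℝ (d v k) x < 0}
  have hm₁ : ∀ v, v ∈ I₁ ↔ ∀ k, 0 < inner ℝ (d v k) x := fun v ↦ by simp [I₁]
  have hm₂ : ∀ v, v ∈ I₂ ↔ ∀ k, inner ℝ (d v k) x < 0 := fun v ↦ by simp [I₂]
  have hanti : ∀ u v, G.Adj u v → ∃ j k, inner ℝ (d u j) x = - inner ℝ (d v k) x := by
    intro u v h
    obtain ⟨j, hj⟩ := hidx h
    obtain ⟨k, hk⟩ := hidx h.symm
    exact ⟨j, k, by simp only [d, hj, hk, inner_sub_left]; ring⟩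
  have hcount : ∑ v, (if v ∈ I₁ ∪ I₂ then (0 : ℝ) else 2)
      ≤ ∑ v, ∑ k, if inner ℝ (d v k) x * inner ℝ (d v (k + 1)) x < 0 then (1 : ℝ) else 0 := by
    refine Finset.sum_le_sum fun v _ ↦ ?_
    split_ifs with hv
    · exact Finset.sum_nonneg fun k _ ↦ by split_ifs <;> norm_num
    · rw [Finset.mem_union, not_or, hm₁, hm₂] at hv
      rw [Fin.sum_univ_three]
      refine two_le_sum_sign_changes (hx (v, 0)) (hx (v, 1)) (hx (v, 2)) ?_ ?_
      · simpa [Fin.forall_fin_succ] using hv.1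
      · simpa [Fin.forall_fin_succ] using hv.2
  have hcount' : ∑ v, (if v ∈ I₁ ∪ I₂ then (0 : ℝ) else 2)
      = 2 * (Fintype.card V - (I₁ ∪ I₂).card) := by
    have : ∀ v, (if v ∈ I₁ ∪ I₂ then (0 : ℝ) else 2) = 2 - 2 * if v ∈ I₁ ∪ I₂ then 1 else 0 :=
      fun v ↦ by split_ifs <;> norm_num
    simp only [this, Finset.sum_sub_distrib, ← Finset.mul_sum, Finset.sum_boole, Finset.filter_univ_mem,
      Finset.sum_const, Finset.card_univ, nsmul_eq_mul]
    ring
  refine ⟨I₁, I₂, fun u hu v hv h ↦ ?_, fun u hu v hv h ↦ ?_, ?_, ?_⟩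
  · obtain ⟨j, k, hjk⟩ := hanti u v h
    linarith [(hm₁ u).1 hu j, (hm₁ v).1 hv k]
  · obtain ⟨j, k, hjk⟩ := hanti u v h
    linarith [(hm₂ u).1 hu j, (hm₂ v).1 hv k]
  · rw [Finset.disjoint_left]
    exact fun v h₁ h₂ ↦ ((hm₁ v).1 h₁ 0).not_gt ((hm₂ v).1 h₂ 0)
  · have hpi := Real.pi_pos
    rw [Finset.sum_const, Finset.card_univ, nsmul_eq_mul] at hangle
    have key : 2 * ((Fintype.card V : ℝ) - (I₁ ∪ I₂).card) * Real.pi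
        ≤ Fintype.card V * (3 * Real.arccos ((1 - lam) / 4)) := by
      rw [← hcount']
      exact (mul_le_mul_of_nonneg_right hcount hpi.le).trans (hle.trans hangle)
    have : 2 * (1 / 2 - (3 / (4 * Real.pi)) * Real.arccos ((1 - lam) / 4)) * (Fintype.card V : ℝ)
        = (2 * Real.pi * Fintype.card V - Fintype.card V * (3 * Real.arccos ((1 - lam) / 4)))
          / (2 * Real.pi) := by
      field_simp
      ring
    rw [this, div_le_iff₀ (by positivity)]
    linarith
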